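/- Let k be a field of characteristic not 2, K a field extension of k, and s ∈ K with s² = α for some nonzero α ∈ k and s not in the image of k. Let n ≥ 1 (necessarily even) and suppose A ∈ Sp(2n,K) satisfies A² = I and every entry of A is a k-multiple of s. Then there exists an invertible 2n×2n matrix X over k such that, viewing X over K, A = (s/α)·( X · [[0, Iₙ],[α·Iₙ, 0]] · X⁻¹ ), and moreover XᵀJX = (1/2)·[[J_n, 0],[0, (1/α)·J_n]], where J_n denotes the n×n block matrix [[0, I_{n/2}],[-I_{n/2}, 0]]. -/

import Mathlib

open Matrix

/-- The standard symplectic form matrix `J = [[0, Iₙ], [-Iₙ, 0]]`. -/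
def SpJ (n : ℕ) (R : Type*) [CommRing R] : Matrix (Fin n ⊕ Fin n) (Fin n ⊕ Fin n) R :=
  Matrix.fromBlocks 0 1 (-1) 0

/-- `M` belongs to the symplectic group `Sp(2n,R)`, i.e. `Mᵀ J M = J`. -/
def IsSymp {n : ℕ} {R : Type*} [CommRing R]
    (M : Matrix (Fin n ⊕ Fin n) (Fin n ⊕ Fin n) R) : Prop :=
  Mᵀ * SpJ n R * M = SpJ n R

/-- The `n×n` matrix `Jₙ = [[0, I_{n/2}], [-I_{n/2}, 0]]` (for even `n`), written entrywise. -/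
def Jn (n : ℕ) (R : Type*) [CommRing R] : Matrix (Fin n) (Fin n) R :=
  Matrix.of fun i j : Fin n =>
    if (i : ℕ) + n / 2 = (j : ℕ) then 1 else if (j : ℕ) + n / 2 = (i : ℕ) then -1 else 0

theorem SpJ_transpose (n : ℕ) (R : Type*) [CommRing R] : (SpJ n R)ᵀ = -SpJ n R := by
  simp [SpJ, fromBlocks_transpose, fromBlocks_neg]

theorem SpJ_mul_self (n : ℕ) (R : Type*) [CommRing R] : SpJ n R * SpJ n R = -1 := by
  rw [← fromBlocks_one, fromBlocks_neg]
  simp [SpJ, fromBlocks_multiply]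

section Extension

variable {k N : Type*} [Field k] [Fintype N] [DecidableEq N]

/-- The columns of `P` form, up to the factor `1/2`, a symplectic family for `J` whose
span is `J`-orthogonal to its image under `B`. -/
def IsHalfSymplectic (J B : Matrix N N k) {m : ℕ} (P : Matrix N (Fin m ⊕ Fin m) k) : Prop :=
  Pᵀ * J * P = (2 : k)⁻¹ • SpJ m k ∧ Pᵀ * J * B * P = 0

variable {J B : Matrix N N k} {β : k}

/-- Gram matrix of `P` together with `B * P`. -/
theorem IsHalfSymplectic.gram (hB : Bᵀ * J = J * B) (hBB : B * B = β • (1 : Matrix N N k))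
    {m : ℕ} {P : Matrix N (Fin m ⊕ Fin m) k} (hP : IsHalfSymplectic J B P) :
    (fromCols P (B * P))ᵀ * J * fromCols P (B * P) =
      (2 : k)⁻¹ • fromBlocks (SpJ m k) 0 0 (β • SpJ m k) := by
  have h1 : Pᵀ * Bᵀ * J = Pᵀ * J * B := by rw [Matrix.mul_assoc, hB, ← Matrix.mul_assoc]
  have h2 : Pᵀ * J * B * (B * P) = (2 : k)⁻¹ • β • SpJ m k := by
    rw [Matrix.mul_assoc, ← Matrix.mul_assoc B, hBB, Matrix.smul_mul, Matrix.one_mul,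
      Matrix.mul_smul, hP.1, smul_comm]
  have h3 : Pᵀ * J * (B * P) = 0 := by rw [← Matrix.mul_assoc, hP.2]
  rw [transpose_fromCols, fromRows_mul, fromRows_mul_fromCols, transpose_mul, h1, hP.1, hP.2, h2,
    h3, fromBlocks_smul]
  simp

theorem IsHalfSymplectic.card_le (h2 : (2 : k) ≠ 0) (hβ : β ≠ 0)
    (hB : Bᵀ * J = J * B) (hBB : B * B = β • (1 : Matrix N N k))
    {m : ℕ} {P : Matrix N (Fin m ⊕ Fin m) k} (hP : IsHalfSymplectic J B P) :
    4 * m ≤ Fintype.card N := by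
  have hG := hP.gram hB hBB
  set M := fromCols P (B * P)
  have hinv : ((2 : k) • fromBlocks (-SpJ m k) 0 0 (-(β⁻¹ • SpJ m k)) * Mᵀ * J) * M = 1 := by
    rw [Matrix.mul_assoc, Matrix.mul_assoc, ← Matrix.mul_assoc Mᵀ, hG, smul_mul_smul_comm,
      fromBlocks_multiply, mul_inv_cancel₀ h2, ← fromBlocks_one]
    simp [SpJ_mul_self, smul_smul, hβ]
  have h := rank_mul_le_right ((2 : k) • fromBlocks (-SpJ m k) 0 0 (-(β⁻¹ • SpJ m k)) * Mᵀ * J) M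
  rw [hinv, rank_one] at h
  have := h.trans (rank_le_card_height M)
  simp only [Fintype.card_sum, Fintype.card_fin] at this
  omega

omit [DecidableEq N] in
/-- A nonzero column orthogonal to `P` and to `B * P`. -/
theorem exists_orthogonal_col (J B : Matrix N N k) {m : ℕ} (P : Matrix N (Fin m ⊕ Fin m) k)
    (hm : 4 * m < Fintype.card N) :
    ∃ x : Matrix N Unit k, x ≠ 0 ∧ Pᵀ * J * x = 0 ∧ Pᵀ * J * B * x = 0 := by
  have hker := LinearMap.ker_ne_bot_of_finrank_lt
    (f := (fromRows (Pᵀ * J) (Pᵀ * J * B)).mulVecLin) (by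
      simp only [Module.finrank_fintype_fun_eq_card, Fintype.card_sum, Fintype.card_fin]
      omega)
  obtain ⟨v, hv, hv0⟩ := (Submodule.ne_bot_iff _).1 hker
  rw [LinearMap.mem_ker, mulVecLin_apply, fromRows_mulVec] at hv
  refine ⟨replicateCol Unit v, fun h => hv0 ?_, ?_, ?_⟩
  · funext i
    exact congrFun (congrFun h i) ()
  · ext i j
    exact congrFun hv (Sum.inl i)
  · ext i j
    exact congrFun hv (Sum.inr i)

theorem unit_matrix_eq_smul_one (M : Matrix Unit Unit k) :
    M = M () () • (1 : Matrix Unit Unit k) := by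
  ext i j
  simp [one_apply]

/-- Every nonzero column `x` has a partner `y` with `xᵀ J y = 1/2` and `xᵀ J B y = 0`. -/
theorem exists_partner (h2 : (2 : k) ≠ 0) (hβ : ∀ c : k, c * c ≠ β) (hJ : IsUnit J)
    (hBB : B * B = β • (1 : Matrix N N k)) {x : Matrix N Unit k} (hx : x ≠ 0) :
    ∃ y : Matrix N Unit k, xᵀ * J * y = (2 : k)⁻¹ • 1 ∧ xᵀ * J * B * y = 0 := by
  have hz : ∃ z : Matrix N Unit k, (xᵀ * J * z) () () ≠ 0 := by
    by_contra! h
    apply hx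
    have h0 : xᵀ * J = 0 := by
      ext i j
      simpa [Matrix.mul_apply, Pi.single_apply] using h (replicateCol Unit (Pi.single j 1))
    obtain ⟨J', hJ'⟩ := hJ.exists_right_inv
    have := congrArg (· * J') h0
    simp only [Matrix.mul_assoc, hJ', Matrix.mul_one, Matrix.zero_mul] at this
    simpa using congrArg transpose this
  obtain ⟨z, hz⟩ := hz
  have hu := unit_matrix_eq_smul_one (xᵀ * J * z)
  have hw := unit_matrix_eq_smul_one (xᵀ * J * B * z)
  set u := (xᵀ * J * z) () ()
  set w := (xᵀ * J * B * z) () ()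
  have hd : β * u ^ 2 - w ^ 2 ≠ 0 := by
    intro h
    apply hβ (w / u)
    field_simp
    linear_combination -h
  set d := β * u ^ 2 - w ^ 2 with hd_def
  have hBBz : xᵀ * J * B * (B * z) = (β * u) • 1 := by
    rw [Matrix.mul_assoc, ← Matrix.mul_assoc B, hBB, Matrix.smul_mul, Matrix.one_mul,
      Matrix.mul_smul, hu, smul_smul]
  refine ⟨(β * u / (2 * d)) • z + (-w / (2 * d)) • (B * z), ?_, ?_⟩
  · rw [Matrix.mul_add, Matrix.mul_smul, Matrix.mul_smul, ← Matrix.mul_assoc, hu, hw, smul_smul,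
      smul_smul, ← add_smul]
    congr 1
    field_simp
    rw [hd_def]; ring
  · rw [Matrix.mul_add, Matrix.mul_smul, Matrix.mul_smul, hBBz, hw, smul_smul,
      smul_smul, ← add_smul]
    convert zero_smul k _ using 2
    field_simp
    ring

omit [DecidableEq N] in
theorem transpose_submatrix_id_mul_mul {ι κ : Type*} (M : Matrix N ι k) (S : Matrix N N k)
    (e : κ → ι) :
    (M.submatrix id e)ᵀ * S * M.submatrix id e = (Mᵀ * S * M).submatrix e e :=
  rfl

omit [DecidableEq N] in
theorem transpose_mul_mul_eq_zero_symm {ι κ : Type*} {S : Matrix N N k} (hS : Sᵀ = -S)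
    {P : Matrix N ι k} {Q : Matrix N κ k} (h : Pᵀ * S * Q = 0) : Qᵀ * S * P = 0 := by
  have := congrArg transpose h
  rw [transpose_mul, transpose_mul, transpose_transpose, hS, transpose_zero, Matrix.neg_mul,
    Matrix.mul_neg, neg_eq_zero] at this
  rw [Matrix.mul_assoc, this]

omit [DecidableEq N] in
theorem transpose_mul_eq_neg (hJ : Jᵀ = -J) (hB : Bᵀ * J = J * B) : (J * B)ᵀ = -(J * B) := by
  rw [transpose_mul, hJ, Matrix.mul_neg, hB]

/-- Removing from `y` its component along `P` and `B * P`. -/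
theorem IsHalfSymplectic.exists_projection (h2 : (2 : k) ≠ 0) (hβ : β ≠ 0) (hJ : Jᵀ = -J)
    (hB : Bᵀ * J = J * B) (hBB : B * B = β • (1 : Matrix N N k))
    {m : ℕ} {P : Matrix N (Fin m ⊕ Fin m) k} (hP : IsHalfSymplectic J B P)
    {x : Matrix N Unit k} (hx : Pᵀ * J * x = 0) (hBx : Pᵀ * J * B * x = 0)
    (y : Matrix N Unit k) :
    ∃ y' : Matrix N Unit k, Pᵀ * J * y' = 0 ∧ Pᵀ * J * B * y' = 0 ∧
      xᵀ * J * y' = xᵀ * J * y ∧ xᵀ * J * B * y' = xᵀ * J * B * y := by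
  have hxP : xᵀ * J * P = 0 := transpose_mul_mul_eq_zero_symm hJ hx
  have hxBP : xᵀ * J * B * P = 0 := by
    rw [Matrix.mul_assoc] at hBx ⊢
    rw [Matrix.mul_assoc, ← Matrix.mul_assoc J, ← Matrix.mul_assoc]
    apply transpose_mul_mul_eq_zero_symm (transpose_mul_eq_neg hJ hB)
    simpa only [Matrix.mul_assoc] using hBx
  obtain ⟨hP1, hP2⟩ := hP
  set a := Pᵀ * J * y with ha
  set b := Pᵀ * J * B * y with hb
  have hBBP (C : Matrix (Fin m ⊕ Fin m) Unit k) : B * (B * (P * C)) = β • (P * C) := by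
    rw [← Matrix.mul_assoc, hBB, Matrix.smul_mul, Matrix.one_mul]
  have hSS (C : Matrix (Fin m ⊕ Fin m) Unit k) : SpJ m k * (SpJ m k * C) = -C := by
    rw [← Matrix.mul_assoc, SpJ_mul_self, Matrix.neg_mul, Matrix.one_mul]
  have e1 (C : Matrix (Fin m ⊕ Fin m) Unit k) :
      Pᵀ * (J * (P * C)) = (2 : k)⁻¹ • (SpJ m k * C) := by
    rw [← Matrix.smul_mul, ← hP1]; simp only [Matrix.mul_assoc]
  have e2 (C : Matrix (Fin m ⊕ Fin m) Unit k) : Pᵀ * (J * (B * (P * C))) = 0 := by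
    rw [← Matrix.zero_mul C, ← hP2]; simp only [Matrix.mul_assoc]
  have e3 (C : Matrix (Fin m ⊕ Fin m) Unit k) : xᵀ * (J * (P * C)) = 0 := by
    rw [← Matrix.zero_mul C, ← hxP]; simp only [Matrix.mul_assoc]
  have e4 (C : Matrix (Fin m ⊕ Fin m) Unit k) : xᵀ * (J * (B * (P * C))) = 0 := by
    rw [← Matrix.zero_mul C, ← hxBP]; simp only [Matrix.mul_assoc]
  simp only [Matrix.mul_assoc] at ha hb
  refine ⟨y + ((2 : k) • (P * (SpJ m k * a)) + (2 * β⁻¹) • (B * (P * (SpJ m k * b)))),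
    ?_, ?_, ?_, ?_⟩ <;>
    simp [Matrix.mul_assoc, Matrix.mul_add, hBBP, hSS, e1, e2, e3, e4, ← ha, ← hb, smul_smul,
      h2]
  rw [show 2 * β⁻¹ * (β * (2 : k)⁻¹) = 1 by field_simp, one_smul, add_neg_cancel]

theorem IsHalfSymplectic.exists_succ (h2 : (2 : k) ≠ 0) (hβ : ∀ c : k, c * c ≠ β)
    (hJ : Jᵀ = -J) (hJu : IsUnit J)
    (hB : Bᵀ * J = J * B) (hBB : B * B = β • (1 : Matrix N N k))
    {m : ℕ} {P : Matrix N (Fin m ⊕ Fin m) k} (hP : IsHalfSymplectic J B P)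
    (hm : 4 * m < Fintype.card N) :
    ∃ P' : Matrix N (Fin (m + 1) ⊕ Fin (m + 1)) k, IsHalfSymplectic J B P' := by
  have hβ0 : β ≠ 0 := fun h => hβ 0 (by simp [h])
  have hJB := transpose_mul_eq_neg hJ hB
  have skew {S : Matrix N N k} (hS : Sᵀ = -S) (x : Matrix N Unit k) : xᵀ * S * x = 0 := by
    have h1 : (xᵀ * S * x)ᵀ = -(xᵀ * S * x) := by
      rw [transpose_mul, transpose_mul, transpose_transpose, hS, Matrix.neg_mul,
        Matrix.mul_neg, Matrix.mul_assoc]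
    have h3 := congrFun (congrFun h1 ()) ()
    rw [transpose_apply, neg_apply, eq_neg_iff_add_eq_zero, ← two_mul] at h3
    ext i j
    exact (mul_eq_zero.1 h3).resolve_left h2
  have flip {S : Matrix N N k} (hS : Sᵀ = -S) (x y : Matrix N Unit k) :
      yᵀ * S * x = -(xᵀ * S * y)ᵀ := by
    rw [transpose_mul, transpose_mul, transpose_transpose, hS, Matrix.neg_mul,
      Matrix.mul_neg, neg_neg, Matrix.mul_assoc]
  obtain ⟨x, hx0, hx, hBx⟩ := exists_orthogonal_col J B P hm
  obtain ⟨y₀, hxy₀, hxBy₀⟩ := exists_partner h2 hβ hJu hBB hx0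
  obtain ⟨y, hy, hBy, hxy, hxBy⟩ := hP.exists_projection h2 hβ0 hJ hB hBB hx hBx y₀
  rw [hxy₀] at hxy
  rw [hxBy₀] at hxBy
  obtain ⟨hP1, hP2⟩ := hP
  have hyx : yᵀ * J * x = -((2 : k)⁻¹ • 1) := by rw [flip hJ, hxy]; simp
  rw [Matrix.mul_assoc _ J] at hP2 hBx hBy hxBy
  have hyBx : yᵀ * (J * B) * x = 0 := by rw [flip hJB, hxBy]; simp
  have hxP := transpose_mul_mul_eq_zero_symm hJ hx
  have hyP := transpose_mul_mul_eq_zero_symm hJ hy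
  have hxBP := transpose_mul_mul_eq_zero_symm hJB hBx
  have hyBP := transpose_mul_mul_eq_zero_symm hJB hBy
  have hxx := skew hJ x
  have hyy := skew hJ y
  have hxBx := skew hJB x
  have hyBy := skew hJB y
  let e : Fin (m + 1) ⊕ Fin (m + 1) ≃ (Fin m ⊕ Fin m) ⊕ (Unit ⊕ Unit) :=
    (Equiv.sumCongr (finSumFinEquiv.symm.trans (Equiv.sumCongr (Equiv.refl _) finOneEquiv))
      (finSumFinEquiv.symm.trans (Equiv.sumCongr (Equiv.refl _) finOneEquiv))).trans
      (Equiv.sumSumSumComm _ _ _ _)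
  have gram (S : Matrix N N k) :
      ((fromCols P (fromCols x y)).submatrix id e)ᵀ * S *
        (fromCols P (fromCols x y)).submatrix id e =
      (fromBlocks (Pᵀ * S * P) (fromCols (Pᵀ * S * x) (Pᵀ * S * y))
        (fromRows (xᵀ * S * P) (yᵀ * S * P))
        (fromBlocks (xᵀ * S * x) (xᵀ * S * y) (yᵀ * S * x) (yᵀ * S * y))).submatrix e e := by
    rw [transpose_submatrix_id_mul_mul, transpose_fromCols, transpose_fromCols, fromRows_mul,
      fromRows_mul_fromCols, fromRows_mul, Matrix.mul_fromCols, fromRows_mul,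
      fromRows_mul_fromCols]
  refine ⟨(fromCols P (fromCols x y)).submatrix id e, ?_, ?_⟩
  · rw [gram, hP1, hx, hy, hxP, hyP, hxx, hxy, hyx, hyy]
    ext i j
    rcases i with i | i <;> rcases j with j | j <;> cases i using Fin.lastCases <;>
      cases j using Fin.lastCases <;> simp [e, SpJ, one_apply, (Fin.castSucc_ne_last _).symm]
  · rw [Matrix.mul_assoc _ J, gram, hP2, hBx, hBy, hxBP, hyBP, hxBx, hxBy, hyBx, hyBy]
    simp [e]

theorem exists_isHalfSymplectic (h2 : (2 : k) ≠ 0) (hβ : ∀ c : k, c * c ≠ β)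
    (hJ : Jᵀ = -J) (hJu : IsUnit J)
    (hB : Bᵀ * J = J * B) (hBB : B * B = β • (1 : Matrix N N k)) :
    ∃ (m : ℕ) (P : Matrix N (Fin m ⊕ Fin m) k),
      4 * m = Fintype.card N ∧ IsHalfSymplectic J B P := by
  have hβ0 : β ≠ 0 := fun h => hβ 0 (by simp [h])
  by_contra! H
  have key : ∀ m : ℕ, ∃ P : Matrix N (Fin m ⊕ Fin m) k, IsHalfSymplectic J B P := by
    intro m
    induction m with
    | zero => exact ⟨0, by ext i; exact i.elim Fin.elim0 Fin.elim0, by simp⟩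
    | succ m ih =>
      obtain ⟨P, hP⟩ := ih
      exact hP.exists_succ h2 hβ hJ hJu hB hBB
        (lt_of_le_of_ne (hP.card_le h2 hβ0 hB hBB) fun h => H m P h hP)
  obtain ⟨P, hP⟩ := key (Fintype.card N + 1)
  have := hP.card_le h2 hβ0 hB hBB
  omega

end Extension

theorem Jn_add_self (m : ℕ) (R : Type*) [CommRing R] :
    Jn (m + m) R = (SpJ m R).submatrix finSumFinEquiv.symm finSumFinEquiv.symm := by
  have hm : (m + m) / 2 = m := by omega
  ext i j
  refine Fin.addCases (fun i => ?_) (fun i => ?_) i <;>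
    refine Fin.addCases (fun j => ?_) (fun j => ?_) j <;>
    simp only [Jn, SpJ, hm, of_apply, submatrix_apply, finSumFinEquiv_symm_apply_castAdd,
      finSumFinEquiv_symm_apply_natAdd, fromBlocks_apply₁₁, fromBlocks_apply₁₂,
      fromBlocks_apply₂₁, fromBlocks_apply₂₂, Fin.val_castAdd, Fin.val_natAdd, one_apply,
      Matrix.neg_apply, Matrix.zero_apply, Fin.ext_iff] <;>
    split_ifs <;> first | omega | simp

/-- Characterization of Type 2 involutions: a symplectic `A` over `K` with `A² = I` whose
entries are `k`-multiples of `s = √α ∉ k` is of the form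
`(s/α)·X·[[0,Iₙ],[αIₙ,0]]·X⁻¹` with `X` over `k` satisfying
`XᵀJX = (1/2)·[[Jₙ,0],[0,(1/α)Jₙ]]`. -/
theorem stmt9 {k K : Type*} [Field k] [Field K] [Algebra k K]
    (hchar : (2 : k) ≠ 0) (s : K) (α : k) (hα : α ≠ 0) (hs : s ^ 2 = algebraMap k K α)
    (hsk : s ∉ Set.range (algebraMap k K)) {n : ℕ} (hn : 1 ≤ n)
    (A : Matrix (Fin n ⊕ Fin n) (Fin n ⊕ Fin n) K) (hA : IsSymp A)
    (h2 : A * A = 1)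
    (hent : ∀ i j, ∃ c : k, A i j = algebraMap k K c * s) :
    ∃ X : Matrix (Fin n ⊕ Fin n) (Fin n ⊕ Fin n) k, IsUnit X ∧
      A = (s / algebraMap k K α) •
          (X.map (algebraMap k K) *
            Matrix.fromBlocks 0 1
              (algebraMap k K α • (1 : Matrix (Fin n) (Fin n) K)) 0 *
            (X.map (algebraMap k K))⁻¹) ∧
      Xᵀ * SpJ n k * X =
        (2 : k)⁻¹ • Matrix.fromBlocks (Jn n k) 0 0 (α⁻¹ • Jn n k) := by
  have hinj := (algebraMap k K).injective
  choose b hb using hent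
  let B : Matrix (Fin n ⊕ Fin n) (Fin n ⊕ Fin n) k := of b
  have hAB : A = s • B.map (algebraMap k K) := by
    ext i j
    simp [B, hb, mul_comm]
  have hJmap : (SpJ n k).map (algebraMap k K) = SpJ n K := by
    simp [SpJ, fromBlocks_map, Matrix.map_neg]
  have hmap {M M' : Matrix (Fin n ⊕ Fin n) (Fin n ⊕ Fin n) k}
      (h : M.map (algebraMap k K) = M'.map (algebraMap k K)) : M = M' :=
    Matrix.map_injective hinj h
  have hBB' : α • (B * B) = 1 := by
    apply hmap
    rw [hAB, Matrix.smul_mul, Matrix.mul_smul, smul_smul, ← sq, hs, ← Matrix.map_mul] at h2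
    rw [Matrix.map_one _ (map_zero _) (map_one _), ← h2,
      Matrix.map_smul' _ _ _ (map_mul (algebraMap k K))]
  have hBB : B * B = α⁻¹ • (1 : Matrix (Fin n ⊕ Fin n) (Fin n ⊕ Fin n) k) := by
    rw [← hBB', smul_smul, inv_mul_cancel₀ hα, one_smul]
  have hBJB : α • (Bᵀ * SpJ n k * B) = SpJ n k := by
    apply hmap
    rw [IsSymp, hAB, transpose_smul, Matrix.smul_mul, Matrix.smul_mul, Matrix.mul_smul, smul_smul,
      ← sq, hs, ← hJmap, ← transpose_map, ← Matrix.map_mul, ← Matrix.map_mul] at hA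
    rw [← hA, Matrix.map_smul' _ _ _ (map_mul (algebraMap k K))]
  have hB : Bᵀ * SpJ n k = SpJ n k * B := by
    calc Bᵀ * SpJ n k = Bᵀ * SpJ n k * (α • (B * B)) := by rw [hBB', Matrix.mul_one]
      _ = α • (Bᵀ * SpJ n k * B) * B := by
        rw [Matrix.mul_smul, Matrix.smul_mul, Matrix.mul_assoc _ B B]
      _ = SpJ n k * B := by rw [hBJB]
  have hβ : ∀ c : k, c * c ≠ α⁻¹ := by
    intro c hc
    have h1 : (s * algebraMap k K c) ^ 2 = 1 := by
      rw [mul_pow, hs, sq, ← map_mul, ← map_mul, hc, mul_inv_cancel₀ hα, map_one]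
    have hc0 : c ≠ 0 := by rintro rfl; simp at h1
    have hc0' : algebraMap k K c ≠ 0 := by simpa using hc0
    rcases eq_or_eq_neg_of_sq_eq_sq _ 1 (h1.trans (one_pow 2).symm) with h | h
    · exact hsk ⟨c⁻¹, by rw [map_inv₀]; field_simp; linear_combination -h⟩
    · exact hsk ⟨-c⁻¹, by rw [map_neg, map_inv₀]; field_simp; linear_combination -h⟩
  have hJu : IsUnit (SpJ n k) := IsUnit.of_mul_eq_one (-SpJ n k) (by simp [SpJ_mul_self])
  obtain ⟨m, P, hm, hP⟩ := exists_isHalfSymplectic hchar hβ (SpJ_transpose n k) hJu hB hBB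
  obtain rfl : n = m + m := by
    simp only [Fintype.card_sum, Fintype.card_fin] at hm
    omega
  let e : Fin (m + m) ≃ Fin m ⊕ Fin m := finSumFinEquiv.symm
  let Q := P.submatrix id e
  let X := fromCols Q (B * Q)
  have hJe := Jn_add_self m k
  have hX : Xᵀ * SpJ (m + m) k * X =
      (2 : k)⁻¹ • fromBlocks (Jn (m + m) k) 0 0 (α⁻¹ • Jn (m + m) k) := by
    have hXP : X = (fromCols P (B * P)).submatrix id (Sum.map e e) := by
      ext i j
      rcases j with j | j <;> rfl
    rw [hXP, transpose_submatrix_id_mul_mul, hP.gram hB hBB, hJe]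
    ext i j
    rcases i with i | i <;> rcases j with j | j <;> rfl
  have hXu : IsUnit X := by
    have hJJ : Jn (m + m) k * Jn (m + m) k = -1 := by
      rw [hJe, submatrix_mul_equiv, SpJ_mul_self, submatrix_neg, Pi.neg_apply, Pi.neg_apply,
        submatrix_one_equiv]
    refine IsUnit.of_mul_eq_one_right
      ((2 : k) • fromBlocks (-Jn (m + m) k) 0 0 (-(α • Jn (m + m) k)) * (Xᵀ * SpJ (m + m) k)) ?_
    rw [Matrix.mul_assoc, hX, smul_mul_smul_comm, fromBlocks_multiply, mul_inv_cancel₀ hchar,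
      ← fromBlocks_one]
    simp [hJJ, smul_smul, hα]
  refine ⟨X, hXu, ?_, hX⟩
  have hXF : B * X = α⁻¹ • (X * fromBlocks 0 1 (α • 1) 0) := by
    rw [fromCols_mul_fromBlocks, Matrix.mul_fromCols, ← Matrix.mul_assoc, hBB]
    ext i j
    rcases j with j | j <;> simp [hα]
  have hF : (fromBlocks 0 1 (α • 1) 0 : Matrix (Fin (m + m) ⊕ Fin (m + m))
      (Fin (m + m) ⊕ Fin (m + m)) k).map
      (algebraMap k K) = fromBlocks 0 1 (algebraMap k K α • 1) 0 := by
    rw [fromBlocks_map, Matrix.map_smul' _ _ _ (map_mul (algebraMap k K))]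
    simp
  have hdet : IsUnit (X.map (algebraMap k K)).det :=
    (isUnit_iff_isUnit_det _).1 (hXu.map (algebraMap k K).mapMatrix)
  have hAX : A * X.map (algebraMap k K) = (s / algebraMap k K α) •
      (X.map (algebraMap k K) * fromBlocks 0 1 (algebraMap k K α • 1) 0) := by
    rw [hAB, Matrix.smul_mul, ← Matrix.map_mul, hXF,
      Matrix.map_smul' _ _ _ (map_mul (algebraMap k K)), Matrix.map_mul, hF, smul_smul, map_inv₀,
      div_eq_mul_inv]
  rw [← Matrix.smul_mul, ← hAX, mul_nonsing_inv_cancel_right _ _ hdet]
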